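/- Let Ω ⊂ ℝ² be a bounded open set with |Ω| > 0, let n ≥ 1, and let Γ_1, …, Γ_n ⊂ ℝ² be segments, where Γ_j has length h_j with 0 < h_j ≤ e^{−2} and midpoint q_j; assume h = ∑_{j=1}^n h_j ≤ |Ω|/(2π). Then there exists a Lipschitz function u : ℝ² → ℝ with 0 ≤ u ≤ 1, vanishing on the union of the closed balls of center q_j and radius h_j (hence on a neighborhood of each Γ_j), such that ∫_Ω u² ≥ |Ω|/2 and ∫_Ω ‖Du(x)‖² dx ≤ 4π n² / |ln(h/n)|; in particular ∫_Ω ‖Du‖² ≤ (8π n²/(|Ω| · |ln(h/n)|)) · ∫_Ω u². -/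

import Mathlib

open MeasureTheory Metric

open Set Real Topology

/-- The logarithmic cutoff around `q`: it is `0` within distance `r` of `q`, is `1` at distance
at least `R`, and is an affine function of the logarithm of the distance in between. -/
noncomputable def logCutoff {E : Type*} [Dist E] (r R : ℝ) (q x : E) : ℝ :=
  min 1 (log (max (dist x q) r / r) / log (R / r))

/-- The square of the norm of the gradient of the logarithmic cutoff, at distance `t` from the
center. -/
noncomputable def logCutoffDensity (r R : ℝ) : ℝ → ℝ :=
  (Ioo r R).indicator fun t => (t * log (R / r))⁻¹ ^ 2

section LogCutoff

variable {E : Type*} {r R : ℝ}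

lemma logCutoff_nonneg [Dist E] (hr : 0 < r) (hR : r < R) (q x : E) :
    0 ≤ logCutoff r R q x := by
  have : 0 ≤ log (R / r) := log_nonneg ((one_le_div hr).2 hR.le)
  have : 0 ≤ log (max (dist x q) r / r) := log_nonneg ((one_le_div hr).2 (le_max_right _ _))
  exact le_min zero_le_one (by positivity)

lemma logCutoff_le_one [Dist E] (q x : E) : logCutoff r R q x ≤ 1 := min_le_left _ _

lemma logCutoff_eq_zero [Dist E] (hr : 0 < r) {q x : E} (hx : dist x q ≤ r) :
    logCutoff r R q x = 0 := by
  simp [logCutoff, max_eq_right hx, div_self hr.ne']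

lemma logCutoff_eq_one [Dist E] (hr : 0 < r) (hR : r < R) {q x : E} (hx : R ≤ dist x q) :
    logCutoff r R q x = 1 := by
  have : 0 < log (R / r) := log_pos ((one_lt_div hr).2 hR)
  refine min_eq_left ((one_le_div this).2 (log_le_log (div_pos (hr.trans hR) hr) ?_))
  gcongr
  exact hx.trans (le_max_left _ _)

lemma logCutoff_eq [Dist E] (hr : 0 < r) (hR : r < R) {q x : E}
    (hx : dist x q ∈ Ioo r R) : logCutoff r R q x = log (dist x q / r) / log (R / r) := by
  have : 0 < log (R / r) := log_pos ((one_lt_div hr).2 hR)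
  rw [logCutoff, max_eq_left hx.1.le]
  refine min_eq_right ((div_le_one this).2 (log_le_log (div_pos (hr.trans hx.1) hr) ?_))
  gcongr
  exact hx.2.le

lemma dist_mem_Ioo_of_logCutoff_mem_Ioo [Dist E] (hr : 0 < r) (hR : r < R) {q x : E}
    (hx : logCutoff r R q x ∈ Ioo 0 1) : dist x q ∈ Ioo r R := by
  constructor <;> by_contra! h
  · exact hx.1.ne' (logCutoff_eq_zero hr h)
  · exact hx.2.ne (logCutoff_eq_one hr hR h)

lemma exists_lipschitzWith_logCutoff [PseudoMetricSpace E] (hr : 0 < r) (hR : r < R) (q : E) :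
    ∃ K, LipschitzWith K (logCutoff r R q) := by
  have hl : 0 < log (R / r) := log_pos ((one_lt_div hr).2 hR)
  refine ⟨_, LipschitzWith.of_le_add_mul' (1 / r / log (R / r)) fun x y => ?_⟩
  have hX : 0 < max (dist x q) r := lt_max_of_lt_right hr
  have hY : 0 < max (dist y q) r := lt_max_of_lt_right hr
  have hd := dist_nonneg (x := x) (y := y)
  have hXY : max (dist x q) r ≤ max (dist y q) r + dist x y := by
    refine max_le ?_ ((le_max_right _ _).trans (by linarith))
    linarith [dist_triangle x y q, le_max_left (dist y q) r]
  have key : log (max (dist x q) r / r) ≤ log (max (dist y q) r / r) + 1 / r * dist x y := by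
    rw [log_div hX.ne' hr.ne', log_div hY.ne' hr.ne']
    have h1 := log_le_sub_one_of_pos (div_pos hX hY)
    rw [log_div hX.ne' hY.ne'] at h1
    have h2 : max (dist x q) r / max (dist y q) r - 1 ≤ 1 / r * dist x y := by
      rw [div_sub_one hY.ne']
      calc _ ≤ dist x y / max (dist y q) r := by gcongr; linarith
        _ ≤ dist x y / r := by gcongr; exact le_max_right _ _
        _ = _ := by ring
    linarith
  have key' := div_le_div_of_nonneg_right key hl.le
  rw [add_div, mul_div_right_comm] at key'
  have : 0 ≤ 1 / r / log (R / r) * dist x y := by positivity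
  unfold logCutoff
  rw [min_add]
  exact min_le_min (by linarith) key'

lemma logCutoffDensity_nonneg (t : ℝ) : 0 ≤ logCutoffDensity r R t :=
  indicator_nonneg (fun _ _ => sq_nonneg _) t

lemma differentiableAt_logCutoff [NormedAddCommGroup E] [InnerProductSpace ℝ E]
    (hr : 0 < r) (hR : r < R) {q x : E} (hx : dist x q ∈ Ioo r R) :
    DifferentiableAt ℝ (logCutoff r R q) x ∧
      ‖fderiv ℝ (logCutoff r R q) x‖ ^ 2 ≤ logCutoffDensity r R (dist x q) := by
  have hl : 0 < log (R / r) := log_pos ((one_lt_div hr).2 hR)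
  have hd : 0 < dist x q := hr.trans hx.1
  have hdiff : DifferentiableAt ℝ (fun y => dist y q) x := by
    simp only [dist_eq_norm]
    exact (differentiableAt_id.sub_const q).norm ℝ (sub_ne_zero.2 (dist_pos.1 hd))
  have hD : HasFDerivAt (fun y => log (dist y q / r) / log (R / r))
      ((dist x q * log (R / r))⁻¹ • fderiv ℝ (fun y => dist y q) x) x := by
    have h1 : HasDerivAt (fun t => log (t / r) / log (R / r)) (dist x q * log (R / r))⁻¹
        (dist x q) := by
      refine HasDerivAt.congr_deriv ((((hasDerivAt_id' (dist x q)).div_const r).log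
        (div_pos hd hr).ne').div_const (log (R / r))) ?_
      field_simp
    exact h1.comp_hasFDerivAt x hdiff.hasFDerivAt
  have hev : logCutoff r R q =ᶠ[𝓝 x] fun y => log (dist y q / r) / log (R / r) := by
    have : ∀ᶠ y in 𝓝 x, dist y q ∈ Ioo r R :=
      (continuous_id.dist continuous_const).continuousAt.eventually (isOpen_Ioo.mem_nhds hx)
    filter_upwards [this] with y hy using logCutoff_eq hr hR hy
  have hD' := hD.congr_of_eventuallyEq hev
  refine ⟨hD'.differentiableAt, ?_⟩
  rw [hD'.fderiv, logCutoffDensity, indicator_of_mem hx, norm_smul,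
    norm_of_nonneg (by positivity : 0 ≤ (dist x q * log (R / r))⁻¹)]
  gcongr
  refine mul_le_of_le_one_right (by positivity) ?_
  simpa using norm_fderiv_le_of_lipschitz ℝ (x₀ := x) (LipschitzWith.dist_left q)

/-- A function between `0` and `1` which is a pointwise minimum of logarithmic cutoffs has its
gradient controlled by those of the cutoffs. -/
lemma norm_fderiv_sq_le_sum [NormedAddCommGroup E] [InnerProductSpace ℝ E] {ι : Type*}
    [Fintype ι] {r R : ι → ℝ} {q : ι → E} (hr : ∀ j, 0 < r j) (hR : ∀ j, r j < R j) {u : E → ℝ}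
    (hu : ∀ x, u x ∈ Icc 0 1) (hle : ∀ x j, u x ≤ logCutoff (r j) (R j) (q j) x)
    (heq : ∀ x, ∃ j, u x = logCutoff (r j) (R j) (q j) x) (x : E) :
    ‖fderiv ℝ u x‖ ^ 2 ≤ ∑ j, logCutoffDensity (r j) (R j) (dist x (q j)) := by
  have hnonneg : 0 ≤ ∑ j, logCutoffDensity (r j) (R j) (dist x (q j)) :=
    Finset.sum_nonneg fun j _ => logCutoffDensity_nonneg _
  by_cases hd : DifferentiableAt ℝ u x
  swap
  · simpa [fderiv_zero_of_not_differentiableAt hd] using hnonneg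
  rcases (hu x).1.eq_or_lt with h0 | h0
  · have : IsLocalMin u x := Filter.Eventually.of_forall fun y => h0 ▸ (hu y).1
    simpa [this.fderiv_eq_zero] using hnonneg
  rcases (hu x).2.eq_or_lt with h1 | h1
  · have : IsLocalMax u x := Filter.Eventually.of_forall fun y => h1 ▸ (hu y).2
    simpa [this.fderiv_eq_zero] using hnonneg
  obtain ⟨j, hj⟩ := heq x
  obtain ⟨hdj, hn⟩ := differentiableAt_logCutoff (hr j) (hR j)
    (dist_mem_Ioo_of_logCutoff_mem_Ioo (hr j) (hR j) (x := x) (q := q j) (hj ▸ ⟨h0, h1⟩))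
  have hmax : IsLocalMax (fun y => u y - logCutoff (r j) (R j) (q j) y) x := by
    refine Filter.Eventually.of_forall fun y => ?_
    simp only [hj, sub_self, sub_nonpos, hle]
  have hfd : fderiv ℝ u x = fderiv ℝ (logCutoff (r j) (R j) (q j)) x :=
    sub_eq_zero.1 (hmax.hasFDerivAt_eq_zero (hd.hasFDerivAt.sub hdj.hasFDerivAt))
  rw [hfd]
  exact hn.trans (Finset.single_le_sum
    (f := fun j => logCutoffDensity (r j) (R j) (dist x (q j)))
    (fun j _ => logCutoffDensity_nonneg _) (Finset.mem_univ j))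

lemma mul_logCutoffDensity (hr : 0 < r) (t : ℝ) :
    t * logCutoffDensity r R t = (Ioo r R).indicator (fun t => (log (R / r) ^ 2)⁻¹ * t⁻¹) t := by
  by_cases ht : t ∈ Ioo r R
  · have : 0 < t := hr.trans ht.1
    rw [logCutoffDensity, indicator_of_mem ht, indicator_of_mem ht, mul_inv, mul_pow]
    field_simp
  · simp [logCutoffDensity, ht]

lemma integrable_logCutoffDensity (hr : 0 < r) (q : EuclideanSpace ℝ (Fin 2)) :
    Integrable (fun x => logCutoffDensity r R (dist x q)) := by
  simp only [dist_eq_norm]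
  refine Integrable.comp_sub_right (f := fun x : EuclideanSpace ℝ (Fin 2) =>
    logCutoffDensity r R ‖x‖) ?_ q
  rw [integrable_fun_norm_addHaar]
  simp only [finrank_euclideanSpace, Fintype.card_fin, Nat.add_one_sub_one, pow_one, smul_eq_mul,
    mul_logCutoffDensity hr]
  refine Integrable.integrableOn ((integrable_indicator_iff measurableSet_Ioo).2 ?_)
  refine (ContinuousOn.integrableOn_Icc ?_).mono_set Ioo_subset_Icc_self
  exact continuousOn_const.mul (continuousOn_inv₀.mono fun t ht => (hr.trans_le ht.1).ne')

/-- The Dirichlet energy of a logarithmic cutoff in the plane. -/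
lemma integral_logCutoffDensity (hr : 0 < r) (hR : r < R) (q : EuclideanSpace ℝ (Fin 2)) :
    ∫ x, logCutoffDensity r R (dist x q) = 2 * π / log (R / r) := by
  have hl : 0 < log (R / r) := log_pos ((one_lt_div hr).2 hR)
  simp only [dist_eq_norm]
  rw [integral_sub_right_eq_self (fun x : EuclideanSpace ℝ (Fin 2) => logCutoffDensity r R ‖x‖) q,
    integral_fun_norm_addHaar]
  simp only [finrank_euclideanSpace, Fintype.card_fin, Nat.add_one_sub_one, pow_one, smul_eq_mul,
    mul_logCutoffDensity hr]
  have hsub : Ioi (0 : ℝ) ∩ Ioo r R = Ioo r R :=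
    inter_eq_right.2 fun t ht => hr.trans ht.1
  rw [setIntegral_indicator measurableSet_Ioo, hsub, ← integral_Ioc_eq_integral_Ioo,
    ← intervalIntegral.integral_of_le hR.le, intervalIntegral.integral_const_mul,
    integral_inv_of_pos hr (hr.trans hR), Measure.real, EuclideanSpace.volume_ball_fin_two]
  simp [pi_nonneg]
  field_simp

end LogCutoff

lemma inv_neg_log_le_div_abs_log {ι : Type*} [Fintype ι] {h : ι → ℝ} (hpos : ∀ j, 0 < h j)
    (hle : ∀ j, h j ≤ exp (-2)) (j : ι) :
    (-log (h j))⁻¹ ≤ Fintype.card ι / |log ((∑ i, h i) / Fintype.card ι)| := by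
  have : Nonempty ι := ⟨j⟩
  have hn : (1 : ℝ) ≤ Fintype.card ι := by exact_mod_cast Fintype.card_pos (α := ι)
  have hn0 : (0 : ℝ) < Fintype.card ι := by linarith
  have hj : log (h j) ≤ -2 := by simpa using log_le_log (hpos j) (hle j)
  have hs : h j ≤ ∑ i, h i :=
    Finset.single_le_sum (fun i _ => (hpos i).le) (Finset.mem_univ j)
  have hs0 : 0 < ∑ i, h i := (hpos j).trans_le hs
  have hmean : (∑ i, h i) / Fintype.card ι ≤ exp (-2) := by
    rw [div_le_iff₀ hn0]
    calc ∑ i, h i ≤ ∑ _i : ι, exp (-2) := Finset.sum_le_sum fun i _ => hle i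
      _ = _ := by simp [mul_comm]
  have hm : log ((∑ i, h i) / Fintype.card ι) ≤ -2 := by
    simpa using log_le_log (div_pos hs0 hn0) hmean
  have hlow := log_le_log (hpos j) hs
  have hlogn := log_le_sub_one_of_pos hn0
  rw [abs_of_neg (by linarith), inv_eq_one_div, div_le_div_iff₀ (by linarith) (by linarith),
    log_div hs0.ne' hn0.ne']
  nlinarith

lemma volume_sub_sum_le_integral_sq {ι : Type*} [Fintype ι] {Ω : Set (EuclideanSpace ℝ (Fin 2))}
    (hΩ : volume Ω ≠ ⊤) {q : ι → EuclideanSpace ℝ (Fin 2)} {R : ι → ℝ} (hR : ∀ j, 0 ≤ R j)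
    {u : EuclideanSpace ℝ (Fin 2) → ℝ} (hu : Continuous u) (hu01 : ∀ x, u x ∈ Icc 0 1)
    (hu1 : ∀ x, (∀ j, R j ≤ dist x (q j)) → u x = 1) :
    (volume Ω).toReal - ∑ j, π * R j ^ 2 ≤ ∫ x in Ω, u x ^ 2 := by
  have : IsFiniteMeasure (volume.restrict Ω) := ⟨by simpa using hΩ.lt_top⟩
  have hg : ∀ j, Integrable ((ball (q j) (R j)).indicator fun _ => (1 : ℝ))
      (volume.restrict Ω) := fun j =>
    (integrable_const (1 : ℝ)).indicator measurableSet_ball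
  have hsum : Integrable (fun x => ∑ j, (ball (q j) (R j)).indicator (fun _ => (1 : ℝ)) x)
      (volume.restrict Ω) := integrable_finsetSum _ fun j _ => hg j
  have hball : ∀ j, ∫ x in Ω, (ball (q j) (R j)).indicator (fun _ => (1 : ℝ)) x
      ≤ π * R j ^ 2 := by
    intro j
    rw [integral_indicator measurableSet_ball, setIntegral_const, smul_eq_mul, mul_one]
    calc (volume.restrict Ω).real (ball (q j) (R j)) ≤ volume.real (ball (q j) (R j)) :=
          ENNReal.toReal_mono measure_ball_lt_top.ne (Measure.restrict_apply_le _ _)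
      _ = π * R j ^ 2 := by
          rw [Measure.real, EuclideanSpace.volume_ball_fin_two]
          simp [hR j, pi_nonneg, mul_comm]
  calc (volume Ω).toReal - ∑ j, π * R j ^ 2
      ≤ (volume Ω).toReal - ∑ j, ∫ x in Ω, (ball (q j) (R j)).indicator (fun _ => (1 : ℝ)) x := by
        gcongr with j
        exact hball j
    _ = ∫ x in Ω, (1 - ∑ j, (ball (q j) (R j)).indicator (fun _ => (1 : ℝ)) x) := by
        rw [integral_sub (integrable_const _) hsum, integral_finsetSum _ fun j _ => hg j]
        simp [Measure.real]
    _ ≤ ∫ x in Ω, u x ^ 2 := by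
        refine integral_mono ((integrable_const _).sub hsum) ?_ fun x => ?_
        · refine Integrable.of_bound (hu.pow 2).aestronglyMeasurable 1 (.of_forall fun x => ?_)
          rw [norm_of_nonneg (sq_nonneg _)]
          exact pow_le_one₀ (hu01 x).1 (hu01 x).2
        · by_cases hx : ∀ j, R j ≤ dist x (q j)
          · have : 0 ≤ ∑ j, (ball (q j) (R j)).indicator (fun _ => (1 : ℝ)) x :=
              Finset.sum_nonneg fun j _ => indicator_nonneg (fun _ _ => zero_le_one) x
            simpa [hu1 x hx] using this
          · push Not at hx
            obtain ⟨j, hj⟩ := hx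
            have : (ball (q j) (R j)).indicator (fun _ => (1 : ℝ)) x
                ≤ ∑ j, (ball (q j) (R j)).indicator (fun _ => (1 : ℝ)) x :=
              Finset.single_le_sum (f := fun j => (ball (q j) (R j)).indicator (fun _ => (1 : ℝ)) x)
                (fun j _ => indicator_nonneg (fun _ _ => zero_le_one) x) (Finset.mem_univ j)
            rw [indicator_of_mem (mem_ball.2 hj)] at this
            have h2 := sq_nonneg (u x)
            simp only
            linarith

lemma exists_lipschitzWith_inf' {E ι : Type*} [PseudoMetricSpace E] [Fintype ι] [Nonempty ι]
    {f : ι → E → ℝ} (hf : ∀ j, ∃ K, LipschitzWith K (f j)) :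
    ∃ K, LipschitzWith K fun x => Finset.univ.inf' Finset.univ_nonempty (f · x) := by
  choose K hK using hf
  refine ⟨∑ j, K j, LipschitzWith.of_le_add_mul _ fun x y => ?_⟩
  obtain ⟨j, -, hj⟩ := Finset.exists_mem_eq_inf' (Finset.univ_nonempty (α := ι)) (f · y)
  rw [hj]
  refine (Finset.inf'_le _ (Finset.mem_univ j)).trans (((hK j).le_add_mul x y).trans ?_)
  gcongr
  exact Finset.single_le_sum (fun _ _ => zero_le) (Finset.mem_univ j)

/-- Corollary 2.7 (analytic content): given a bounded open `Ω ⊂ ℝ²` of positive area and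
`n ≥ 1` segments `Γ j` with endpoints `a j, b j`, lengths `h j = d(a j, b j)` satisfying
`0 < h j ≤ e⁻²` and midpoints `q j`, with `h = ∑ⱼ h j ≤ |Ω|/(2π)`, there is a Lipschitz
function `u : ℝ² → ℝ`, `0 ≤ u ≤ 1`, vanishing on each closed ball `B̄(q j, h j)` (hence on a
neighborhood of each `Γ j`), with `∫_Ω u² ≥ |Ω|/2` and
`∫_Ω ‖Du‖² ≤ 4πn²/|ln(h/n)|`; in particular
`∫_Ω ‖Du‖² ≤ (8πn²/(|Ω|·|ln(h/n)|)) ∫_Ω u²`. -/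
theorem stmt_17 (Ω : Set (EuclideanSpace ℝ (Fin 2))) (hΩ : IsOpen Ω)
    (hbd : Bornology.IsBounded Ω) (h0 : 0 < volume Ω) (n : ℕ) (hn : 1 ≤ n)
    (a b : Fin n → EuclideanSpace ℝ (Fin 2)) (h : Fin n → ℝ)
    (hlen : ∀ j, h j = dist (a j) (b j)) (hpos : ∀ j, 0 < h j)
    (hle : ∀ j, h j ≤ Real.exp (-2))
    (hsum : ∑ j, h j ≤ (volume Ω).toReal / (2 * Real.pi)) :
    ∃ u : EuclideanSpace ℝ (Fin 2) → ℝ,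
      (∃ K : NNReal, LipschitzWith K u) ∧
      (∀ x, u x ∈ Set.Icc (0 : ℝ) 1) ∧
      (∀ j, ∀ x ∈ Metric.closedBall (midpoint ℝ (a j) (b j)) (h j), u x = 0) ∧
      ((volume Ω).toReal / 2 ≤ ∫ x in Ω, (u x) ^ 2) ∧
      ((∫ x in Ω, ‖fderiv ℝ u x‖ ^ 2)
          ≤ 4 * Real.pi * (n : ℝ) ^ 2 / |Real.log ((∑ j, h j) / n)|) ∧
      (∫ x in Ω, ‖fderiv ℝ u x‖ ^ 2)
          ≤ (8 * Real.pi * (n : ℝ) ^ 2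
              / ((volume Ω).toReal * |Real.log ((∑ j, h j) / n)|))
            * ∫ x in Ω, (u x) ^ 2 := by
  have : Nonempty (Fin n) := ⟨⟨0, hn⟩⟩
  have hn0 : (0 : ℝ) < n := by exact_mod_cast hn
  have hfin : volume Ω ≠ ⊤ := hbd.measure_lt_top.ne
  have hvol : 0 < (volume Ω).toReal := ENNReal.toReal_pos h0.ne' hfin
  have hlog : ∀ j, log (h j) ≤ -2 := fun j => by simpa using log_le_log (hpos j) (hle j)
  have hR : ∀ j, h j < √(h j) := fun j => by
    rw [lt_sqrt (hpos j).le, sq]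
    exact mul_lt_of_lt_one_left (hpos j) ((hle j).trans_lt (by simp))
  set q : Fin n → EuclideanSpace ℝ (Fin 2) := fun j => midpoint ℝ (a j) (b j) with hq
  let η : Fin n → EuclideanSpace ℝ (Fin 2) → ℝ := fun j => logCutoff (h j) (√(h j)) (q j)
  let u : EuclideanSpace ℝ (Fin 2) → ℝ := fun x =>
    Finset.univ.inf' Finset.univ_nonempty (η · x)
  have hu_le : ∀ x j, u x ≤ η j x := fun x j => Finset.inf'_le _ (Finset.mem_univ j)
  have hu_eq : ∀ x, ∃ j, u x = η j x := fun x => by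
    obtain ⟨j, -, hj⟩ := Finset.exists_mem_eq_inf' (Finset.univ_nonempty (α := Fin n)) (η · x)
    exact ⟨j, hj⟩
  have hu01 : ∀ x, u x ∈ Icc (0 : ℝ) 1 := fun x => by
    obtain ⟨j, hj⟩ := hu_eq x
    exact hj ▸ ⟨logCutoff_nonneg (hpos j) (hR j) _ _, logCutoff_le_one _ _⟩
  obtain ⟨K, hK⟩ : ∃ K, LipschitzWith K u :=
    exists_lipschitzWith_inf' fun j => exists_lipschitzWith_logCutoff (hpos j) (hR j) (q j)
  have hmass : (volume Ω).toReal / 2 ≤ ∫ x in Ω, u x ^ 2 := by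
    refine le_trans ?_ (volume_sub_sum_le_integral_sq hfin (q := q) (fun j => sqrt_nonneg (h j))
      hK.continuous hu01 fun x hx => ?_)
    · simp only [sq_sqrt (hpos _).le, ← Finset.mul_sum]
      rw [le_div_iff₀ (by positivity)] at hsum
      linarith
    · obtain ⟨j, hj⟩ := hu_eq x
      exact hj.trans (logCutoff_eq_one (hpos j) (hR j) (hx j))
  have henergy : (∫ x in Ω, ‖fderiv ℝ u x‖ ^ 2)
      ≤ 4 * π * (n : ℝ) ^ 2 / |log ((∑ j, h j) / n)| := by
    have hg : ∀ j, Integrable fun x => logCutoffDensity (h j) (√(h j)) (dist x (q j)) :=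
      fun j => integrable_logCutoffDensity (hpos j) (q j)
    have hg_sum := integrable_finsetSum Finset.univ fun j _ => hg j
    calc ∫ x in Ω, ‖fderiv ℝ u x‖ ^ 2
        ≤ ∫ x in Ω, ∑ j, logCutoffDensity (h j) (√(h j)) (dist x (q j)) :=
          integral_mono_of_nonneg (.of_forall fun x => sq_nonneg _) hg_sum.integrableOn
            (.of_forall fun x => norm_fderiv_sq_le_sum hpos hR hu01 hu_le hu_eq x)
      _ ≤ ∫ x, ∑ j, logCutoffDensity (h j) (√(h j)) (dist x (q j)) :=
          setIntegral_le_integral hg_sum (.of_forall fun x =>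
            Finset.sum_nonneg fun j _ => logCutoffDensity_nonneg _)
      _ = ∑ j, 4 * π * (-log (h j))⁻¹ := by
          rw [integral_finsetSum _ fun j _ => hg j]
          refine Finset.sum_congr rfl fun j _ => ?_
          rw [integral_logCutoffDensity (hpos j) (hR j),
            log_div (sqrt_pos.2 (hpos j)).ne' (hpos j).ne', log_sqrt (hpos j).le]
          have : log (h j) / 2 - log (h j) = -log (h j) / 2 := by ring
          rw [this]
          have : -log (h j) ≠ 0 := by linarith [hlog j]
          field_simp
          ring
      _ ≤ ∑ _j : Fin n, 4 * π * (n / |log ((∑ j, h j) / n)|) := by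
          gcongr with j
          simpa using inv_neg_log_le_div_abs_log hpos hle j
      _ = 4 * π * (n : ℝ) ^ 2 / |log ((∑ j, h j) / n)| := by
          rw [Finset.sum_const, Finset.card_univ, Fintype.card_fin, nsmul_eq_mul]
          ring
  refine ⟨u, ⟨K, hK⟩, hu01, fun j x hx => ?_, hmass, henergy, henergy.trans ?_⟩
  · exact le_antisymm ((hu_le x j).trans (logCutoff_eq_zero (hpos j) hx).le) (hu01 x).1
  · calc 4 * π * (n : ℝ) ^ 2 / |log ((∑ j, h j) / n)|
        = 8 * π * (n : ℝ) ^ 2 / ((volume Ω).toReal * |log ((∑ j, h j) / n)|)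
            * ((volume Ω).toReal / 2) := by
          rw [mul_comm (volume Ω).toReal, ← div_div]
          field_simp
          ring
      _ ≤ _ := by gcongr
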